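/- Let R → S be a faithfully flat map of commutative rings and M → N a map in D(R). If the derived base change M ⊗^L_R S → N ⊗^L_R S is pure in D(S), then M → N is pure in D(R). -/

import Mathlib

open CategoryTheory Limits Pretriangulated

universe w w' u

noncomputable section

/-- An object of the derived category `D(A)` is perfect if it is isomorphic to a bounded
complex of finitely generated projective modules. -/
def IsPerfectObj {A : Type u} [CommRing A] [HasDerivedCategory.{w} (ModuleCat.{u} A)]
    (P : DerivedCategory (ModuleCat.{u} A)) : Prop :=
  ∃ K : CochainComplex (ModuleCat.{u} A) ℤ,
    (∀ i : ℤ, Module.Finite A (K.X i) ∧ Projective (K.X i)) ∧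
    (∃ a b : ℤ, ∀ i : ℤ, (i < a ∨ b < i) → IsZero (K.X i)) ∧
    Nonempty (P ≅ DerivedCategory.Q.obj K)

/-- A map `M ⟶ N` in `D(A)` is pure if for any distinguished triangle
`M ⟶ N ⟶ Q ⟶ M[1]`, every composition `P ⟶ Q ⟶ M[1]` with `P` perfect is zero. -/
def IsPureMap {A : Type u} [CommRing A] [HasDerivedCategory.{w} (ModuleCat.{u} A)]
    {M N : DerivedCategory (ModuleCat.{u} A)} (φ : M ⟶ N) : Prop :=
  ∀ (Q : DerivedCategory (ModuleCat.{u} A)) (g : N ⟶ Q) (δ : Q ⟶ M⟦(1 : ℤ)⟧),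
    ((Triangle.mk φ g δ) ∈ distTriang (DerivedCategory (ModuleCat.{u} A))) →
    ∀ P : DerivedCategory (ModuleCat.{u} A), IsPerfectObj P → ∀ p : P ⟶ Q, p ≫ δ = 0


open TensorProduct in
/-- Descent of membership in the range of a linear map along a faithfully flat base change. -/
lemma mem_range_of_isBaseChange {R S : Type*} [CommRing R] [CommRing S] [Algebra R S]
    [Module.FaithfullyFlat R S]
    {A B A' B' : Type*} [AddCommMonoid A] [AddCommGroup B] [AddCommMonoid A'] [AddCommMonoid B']
    [Module R A] [Module R B] [Module R A'] [Module R B'] [Module S A'] [Module S B']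
    [IsScalarTower R S A'] [IsScalarTower R S B']
    {εA : A →ₗ[R] A'} {εB : B →ₗ[R] B'} (hA : IsBaseChange S εA) (hB : IsBaseChange S εB)
    (D : A →ₗ[R] B) (D' : A' →ₗ[S] B') (hD : ∀ x, D' (εA x) = εB (D x))
    (y : B) (x' : A') (h : D' x' = εB y) : ∃ x, D x = y := by
  have key : ∀ t : S ⊗[R] A, hB.equiv (D.lTensor S t) = D' (hA.equiv t) := by
    intro t
    induction t using TensorProduct.induction_on with
    | zero => simp
    | tmul s a => simp [IsBaseChange.equiv_tmul, hD]
    | add a b ha hb => simp only [map_add, ha, hb]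
  have h1 : D.lTensor S (hA.equiv.symm x') = 1 ⊗ₜ[R] y := by
    apply hB.equiv.injective
    rw [key]
    simp [IsBaseChange.equiv_tmul, h]
  have h2 : (1 : S) ⊗ₜ[R] (D.range.mkQ y) = 0 := by
    have : (1 : S) ⊗ₜ[R] (D.range.mkQ y) = (D.range.mkQ.lTensor S) (1 ⊗ₜ[R] y) := by simp
    rw [this, ← h1, ← LinearMap.comp_apply, ← LinearMap.lTensor_comp,
      LinearMap.range_mkQ_comp, LinearMap.lTensor_zero, LinearMap.zero_apply]
  rw [Module.FaithfullyFlat.one_tmul_eq_zero_iff] at h2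
  simpa using h2

open TensorProduct in
/-- Descent of null-homotopies, unbundled version. -/
lemma descend_nullHomotopy {R S : Type*} [CommRing R] [CommRing S] [Algebra R S]
    [Module.FaithfullyFlat R S] {K X : ℤ → Type*} [∀ i, AddCommGroup (K i)]
    [∀ i, AddCommGroup (X i)] [∀ i, Module R (K i)] [∀ i, Module R (X i)]
    [∀ i, Module.FinitePresentation R (K i)]
    (dK : ∀ i j, K i →ₗ[R] K j) (dX : ∀ i j, X i →ₗ[R] X j) (a b : ℤ)
    (f : ∀ i, K i →ₗ[R] X i) (h' : ∀ i j, S ⊗[R] K i →ₗ[S] S ⊗[R] X j)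
    (H : ∀ i, (f i).baseChange S = h' (i + 1) i ∘ₗ (dK i (i + 1)).baseChange S +
      (dX (i - 1) i).baseChange S ∘ₗ h' i (i - 1)) :
    ∃ h : ∀ i j, K i →ₗ[R] X j, ∀ i, a ≤ i → i ≤ b → f i = h (i + 1) i ∘ₗ dK i (i + 1) +
      dX (i - 1) i ∘ₗ h i (i - 1) := by
  let I := Set.Icc a b
  let J := Set.Icc (a - 1) (b + 1)
  have m1 : ∀ i : I, (i : ℤ) + 1 ∈ J := fun ⟨i, h1, h2⟩ ↦ ⟨by simp; omega, by simp; omega⟩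
  have m2 : ∀ i : I, (i : ℤ) - 1 ∈ J := fun ⟨i, h1, h2⟩ ↦ ⟨by simp; omega, by simp; omega⟩
  have m3 : ∀ i : I, (i : ℤ) ∈ J := fun ⟨i, h1, h2⟩ ↦ ⟨by simp; omega, by simp; omega⟩
  obtain ⟨D, hD⟩ : ∃ D : (∀ p : J × J, K p.1 →ₗ[R] X p.2) →ₗ[R] (∀ i : I, K i →ₗ[R] X i),
      ∀ x i, D x i = x (⟨i + 1, m1 i⟩, ⟨i, m3 i⟩) ∘ₗ dK i (i + 1) +
        dX (i - 1) i ∘ₗ x (⟨i, m3 i⟩, ⟨i - 1, m2 i⟩) :=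
    ⟨LinearMap.pi fun i ↦
      LinearMap.lcomp R (X i) (dK i (i + 1)) ∘ₗ
        LinearMap.proj ((⟨i + 1, m1 i⟩, ⟨i, m3 i⟩) : J × J) +
      LinearMap.compRight R (dX (i - 1) i) ∘ₗ
        LinearMap.proj ((⟨i, m3 i⟩, ⟨i - 1, m2 i⟩) : J × J), fun _ _ ↦ rfl⟩
  obtain ⟨D', hD'⟩ : ∃ D' : (∀ p : J × J, S ⊗[R] K p.1 →ₗ[S] S ⊗[R] X p.2) →ₗ[S]
      (∀ i : I, S ⊗[R] K i →ₗ[S] S ⊗[R] X i),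
      ∀ x i, D' x i = x (⟨i + 1, m1 i⟩, ⟨i, m3 i⟩) ∘ₗ (dK i (i + 1)).baseChange S +
        (dX (i - 1) i).baseChange S ∘ₗ x (⟨i, m3 i⟩, ⟨i - 1, m2 i⟩) :=
    ⟨LinearMap.pi fun i ↦
      LinearMap.lcomp S (S ⊗[R] X i) ((dK i (i + 1)).baseChange S) ∘ₗ
        LinearMap.proj ((⟨i + 1, m1 i⟩, ⟨i, m3 i⟩) : J × J) +
      LinearMap.compRight S ((dX (i - 1) i).baseChange S) ∘ₗ
        LinearMap.proj ((⟨i, m3 i⟩, ⟨i - 1, m2 i⟩) : J × J), fun _ _ ↦ rfl⟩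
  have hA := IsBaseChange.pi (S := S)
    (fun p : J × J ↦ LinearMap.baseChangeHom R S (K p.1) (X p.2))
    (fun p ↦ Module.FinitePresentation.isBaseChange_map R (K p.1) (X p.2) S)
  have hB := IsBaseChange.pi (S := S)
    (fun i : I ↦ LinearMap.baseChangeHom R S (K i) (X i))
    (fun i ↦ Module.FinitePresentation.isBaseChange_map R (K i) (X i) S)
  have h1 : ∀ x, D' ((LinearMap.pi fun p : J × J ↦
      LinearMap.baseChangeHom R S (K p.1) (X p.2) ∘ₗ LinearMap.proj p) x) =
      (LinearMap.pi fun i : I ↦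
        LinearMap.baseChangeHom R S (K i) (X i) ∘ₗ LinearMap.proj i) (D x) := by
    intro x
    funext i
    rw [hD']
    simp only [LinearMap.pi_apply, LinearMap.comp_apply, LinearMap.proj_apply, hD, map_add,
      LinearMap.baseChangeHom_apply, LinearMap.baseChange_comp]
  have h2 : D' (fun p ↦ h' p.1 p.2) = (LinearMap.pi fun i : I ↦
        LinearMap.baseChangeHom R S (K i) (X i) ∘ₗ LinearMap.proj i) (fun i ↦ f i) := by
    funext i
    rw [hD']
    simp only [LinearMap.pi_apply, LinearMap.comp_apply, LinearMap.proj_apply,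
      LinearMap.baseChangeHom_apply, H i]
  obtain ⟨h, hh⟩ := mem_range_of_isBaseChange (R := R) (S := S)
    (A := ∀ p : J × J, K p.1 →ₗ[R] X p.2) (B := ∀ i : I, K i →ₗ[R] X i)
    (A' := ∀ p : J × J, S ⊗[R] K p.1 →ₗ[S] S ⊗[R] X p.2)
    (B' := ∀ i : I, S ⊗[R] K i →ₗ[S] S ⊗[R] X i) hA hB D D' h1
    (fun i ↦ f i) (fun p ↦ h' p.1 p.2) h2
  classical
  refine ⟨fun i j ↦ if hij : i ∈ J ∧ j ∈ J then h (⟨i, hij.1⟩, ⟨j, hij.2⟩) else 0,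
    fun i h1 h2 ↦ ?_⟩
  have := congr_fun hh ⟨i, h1, h2⟩
  beta_reduce
  rw [dif_pos ⟨m1 ⟨i, h1, h2⟩, m3 ⟨i, h1, h2⟩⟩, dif_pos ⟨m3 ⟨i, h1, h2⟩, m2 ⟨i, h1, h2⟩⟩]
  exact this.symm.trans (hD _ _)

lemma descend_homotopy {R S : Type u} [CommRing R] [CommRing S] {φ : R →+* S}
    (hφ : φ.FaithfullyFlat) [(ModuleCat.extendScalars.{u, u, u} φ).Additive]
    {K X : CochainComplex (ModuleCat.{u} R) ℤ}
    (hK : ∀ i : ℤ, Module.Finite R (K.X i) ∧ Projective (K.X i)) (a b : ℤ)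
    (hab : ∀ i : ℤ, (i < a ∨ b < i) → IsZero (K.X i)) (f : K ⟶ X)
    (h : Homotopy (((ModuleCat.extendScalars.{u, u, u} φ).mapHomologicalComplex
        (ComplexShape.up ℤ)).map f) 0) : Nonempty (Homotopy f 0) := by
  algebraize [φ]
  have hfp : ∀ i, Module.FinitePresentation R (K.X i) := fun i ↦ by
    have := (hK i).1
    have : Module.Projective R (K.X i) := (IsProjective.iff_projective _).2 (hK i).2
    exact Module.finitePresentation_of_projective R (K.X i)
  obtain ⟨g, hg⟩ := descend_nullHomotopy (R := R) (S := S) (K := fun i ↦ K.X i)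
    (X := fun i ↦ X.X i) (fun i j ↦ (K.d i j).hom) (fun i j ↦ (X.d i j).hom) a b
    (fun i ↦ (f.f i).hom) (fun i j ↦ (h.hom i j).hom) (fun i ↦ by
      have := h.comm i
      rw [dNext_eq _ (show (ComplexShape.up ℤ).Rel i (i + 1) by simp),
        prevD_eq _ (show (ComplexShape.up ℤ).Rel (i - 1) i by simp)] at this
      have := congrArg ModuleCat.Hom.hom this
      simp only [HomologicalComplex.zero_f, add_zero] at this
      exact this)
  refine ⟨(Homotopy.ofEq ?_).trans
    (Homotopy.nullHomotopy' fun i j _ ↦ ModuleCat.ofHom (g i j))⟩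
  ext1 i
  by_cases hi : a ≤ i ∧ i ≤ b
  · rw [Homotopy.nullHomotopicMap'_f (show (ComplexShape.up ℤ).Rel (i - 1) i by simp)
      (show (ComplexShape.up ℤ).Rel i (i + 1) by simp)]
    ext1
    exact hg i hi.1 hi.2
  · exact (hab i (by omega)).eq_of_src _ _

lemma Q_map_eq_zero_iff {C : Type*} [Category C] [Abelian C] [HasDerivedCategory C]
    {K L : CochainComplex C ℤ} [K.IsKProjective] (f : K ⟶ L) :
    DerivedCategory.Q.map f = 0 ↔ Nonempty (Homotopy f 0) := by
  refine ⟨fun h ↦ ?_, fun ⟨h⟩ ↦ by rw [DerivedCategory.Q_map_eq_of_homotopy _ h, Functor.map_zero]⟩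
  rw [← HomotopyCategory.quotient_map_eq_zero_iff]
  apply (CochainComplex.IsKProjective.Qh_map_bijective _ _).injective
  rw [← cancel_mono ((DerivedCategory.quotientCompQhIso C).hom.app L)]
  have := (DerivedCategory.quotientCompQhIso C).hom.naturality f
  rw [h] at this
  simpa using this

lemma exists_Q_map_eq {C : Type*} [Category C] [Abelian C] [HasDerivedCategory C]
    {K L : CochainComplex C ℤ} [K.IsKProjective]
    (α : DerivedCategory.Q.obj K ⟶ DerivedCategory.Q.obj L) :
    ∃ f : K ⟶ L, α = DerivedCategory.Q.map f := by
  obtain ⟨g, hg⟩ := (CochainComplex.IsKProjective.Qh_map_bijective K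
    ((HomotopyCategory.quotient _ _).obj L)).surjective
    ((DerivedCategory.quotientCompQhIso C).hom.app K ≫ α ≫
      (DerivedCategory.quotientCompQhIso C).inv.app L)
  obtain ⟨f, rfl⟩ := (HomotopyCategory.quotient _ _).map_surjective g
  refine ⟨f, ?_⟩
  have := (DerivedCategory.quotientCompQhIso C).hom.naturality f
  rw [← cancel_epi ((DerivedCategory.quotientCompQhIso C).hom.app K), ← this]
  simp [hg]

lemma isKProjective_of_bdd {C : Type*} [Category C] [Abelian C] 
    {K : CochainComplex C ℤ} (hK : ∀ i : ℤ, Projective (K.X i)) (b : ℤ)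
    (hb : ∀ i, b < i → IsZero (K.X i)) : K.IsKProjective := by
  have : K.IsStrictlyLE b := (CochainComplex.isStrictlyLE_iff K b).2 hb
  exact CochainComplex.isKProjective_of_projective K b

/-- Injectivity of base change on maps from a perfect complex. -/
lemma baseChange_faithful {R S : Type u} [CommRing R] [CommRing S] {φ : R →+* S}
    (hφ : φ.FaithfullyFlat) [(ModuleCat.extendScalars.{u, u, u} φ).Additive]
    [PreservesFiniteLimits (ModuleCat.extendScalars.{u, u, u} φ)]
    [PreservesFiniteColimits (ModuleCat.extendScalars.{u, u, u} φ)]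
    [HasDerivedCategory.{w} (ModuleCat.{u} R)]
    [HasDerivedCategory.{w'} (ModuleCat.{u} S)]
    {P : DerivedCategory (ModuleCat.{u} R)} (X : DerivedCategory (ModuleCat.{u} R))
    (hP : IsPerfectObj P) (α : P ⟶ X)
    (h : (ModuleCat.extendScalars.{u, u, u} φ).mapDerivedCategory.map α = 0) : α = 0 := by
  set F := ModuleCat.extendScalars.{u, u, u} φ with hF
  obtain ⟨K, hK, ⟨a, b, hab⟩, ⟨e⟩⟩ := hP
  have hKp : K.IsKProjective := isKProjective_of_bdd (fun i ↦ (hK i).2) b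
    (fun i hi ↦ hab i (Or.inr hi))
  let L := DerivedCategory.Q.objPreimage X
  let eX : DerivedCategory.Q.obj L ≅ X := DerivedCategory.Q.objObjPreimageIso X
  have hKp' : CochainComplex.IsKProjective
      ((F.mapHomologicalComplex (ComplexShape.up ℤ)).obj K) :=
    isKProjective_of_bdd (K := (F.mapHomologicalComplex (ComplexShape.up ℤ)).obj K) (fun i ↦ (ModuleCat.extendRestrictScalarsAdj φ).map_projective _ (hK i).2)
      b (fun i hi ↦ F.map_isZero (hab i (Or.inr hi)))
  obtain ⟨f, hf⟩ := exists_Q_map_eq (e.inv ≫ α ≫ eX.inv)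
  have h1 : DerivedCategory.Q.map ((F.mapHomologicalComplex (ComplexShape.up ℤ)).map f) = 0 := by
    have h2 := F.mapDerivedCategoryFactors_hom_naturality f
    rw [← hf, Functor.map_comp, Functor.map_comp, h] at h2
    rw [← cancel_epi (F.mapDerivedCategoryFactors.hom.app K), ← h2]
    simp
  obtain ⟨hh⟩ := (Q_map_eq_zero_iff _).1 h1
  have h3 := (Q_map_eq_zero_iff _).2 (descend_homotopy hφ hK a b hab f hh)
  rw [h3] at hf
  rw [← cancel_epi e.inv, ← cancel_mono eX.inv]
  simpa using hf

lemma isPerfectObj_map {R S : Type u} [CommRing R] [CommRing S] (φ : R →+* S)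
    [(ModuleCat.extendScalars.{u, u, u} φ).Additive]
    [PreservesFiniteLimits (ModuleCat.extendScalars.{u, u, u} φ)]
    [PreservesFiniteColimits (ModuleCat.extendScalars.{u, u, u} φ)]
    [HasDerivedCategory.{w} (ModuleCat.{u} R)]
    [HasDerivedCategory.{w'} (ModuleCat.{u} S)]
    {P : DerivedCategory (ModuleCat.{u} R)} (hP : IsPerfectObj P) :
    IsPerfectObj ((ModuleCat.extendScalars.{u, u, u} φ).mapDerivedCategory.obj P) := by
  obtain ⟨K, hK, ⟨a, b, hab⟩, ⟨e⟩⟩ := hP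
  refine ⟨((ModuleCat.extendScalars.{u, u, u} φ).mapHomologicalComplex (ComplexShape.up ℤ)).obj K,
    fun i ↦ ⟨?_, (ModuleCat.extendRestrictScalarsAdj φ).map_projective _ (hK i).2⟩,
    ⟨a, b, fun i hi ↦ Functor.map_isZero (ModuleCat.extendScalars.{u, u, u} φ) (hab i hi)⟩,
    ⟨Functor.mapIso _ e ≪≫
      (ModuleCat.extendScalars.{u, u, u} φ).mapDerivedCategoryFactors.app K⟩⟩
  algebraize [φ]
  have := (hK i).1
  exact (inferInstance : Module.Finite S (TensorProduct R S (K.X i)))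

/-- Faithfully flat descent of purity: if `R → S` is faithfully flat and the derived base
change `M ⊗^L_R S → N ⊗^L_R S` (computed degreewise, which is the derived tensor since `S`
is flat over `R`) is pure in `D(S)`, then `M → N` is pure in `D(R)`. -/
theorem stmt6 {R S : Type u} [CommRing R] [CommRing S] [Algebra R S]
    [Module.FaithfullyFlat R S]
    [HasDerivedCategory.{w} (ModuleCat.{u} R)]
    [HasDerivedCategory.{w'} (ModuleCat.{u} S)]
    {M N : CochainComplex (ModuleCat.{u} R) ℤ} (φ : M ⟶ N)
    (hpure : IsPureMap (DerivedCategory.Q.map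
      (((ModuleCat.extendScalars (algebraMap R S)).mapHomologicalComplex
        (ComplexShape.up ℤ)).map φ))) :
    IsPureMap (DerivedCategory.Q.map φ) := by
  have hφ : (algebraMap R S).FaithfullyFlat :=
    (RingHom.faithfullyFlat_algebraMap_iff).2 inferInstance
  set F := ModuleCat.extendScalars.{u, u, u} (algebraMap R S) with hF
  have := ModuleCat.preservesFiniteLimits_extendScalars_of_flat hφ.flat
  have : F.Additive := (ModuleCat.extendRestrictScalarsAdj (algebraMap R S)).left_adjoint_additive
  have : PreservesColimits F := (ModuleCat.extendRestrictScalarsAdj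
    (algebraMap R S)).leftAdjoint_preservesColimits
  have : PreservesFiniteColimits F := inferInstance
  intro Q g δ hT P hP p
  apply baseChange_faithful hφ _ hP
  let eM := F.mapDerivedCategoryFactors.app M
  let eN := F.mapDerivedCategoryFactors.app N
  have hT' := F.mapDerivedCategory.map_distinguished _ hT
  let T' : Triangle (DerivedCategory (ModuleCat.{u} S)) := Triangle.mk
    (DerivedCategory.Q.map ((F.mapHomologicalComplex (ComplexShape.up ℤ)).map φ))
    (eN.inv ≫ F.mapDerivedCategory.map g)
    (F.mapDerivedCategory.map δ ≫ (F.mapDerivedCategory.commShiftIso (1 : ℤ)).hom.app _ ≫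
      eM.hom⟦(1 : ℤ)⟧')
  have hT'' : T' ∈ distTriang (DerivedCategory (ModuleCat.{u} S)) := by
    refine isomorphic_distinguished _ hT' _ (Iso.symm (Triangle.isoMk _ _ eM eN (Iso.refl _)
      ?_ ?_ ?_))
    · exact F.mapDerivedCategoryFactors_hom_naturality φ
    · exact (Category.comp_id _).trans (Iso.hom_inv_id_assoc eN _).symm
    · exact (Category.assoc _ _ _).trans (Category.id_comp _).symm
  have h := hpure _ _ _ hT'' _ (isPerfectObj_map (algebraMap R S) hP) (F.mapDerivedCategory.map p)
  rw [← cancel_mono ((F.mapDerivedCategory.commShiftIso (1 : ℤ)).hom.app _ ≫ eM.hom⟦(1 : ℤ)⟧'),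
    Functor.map_comp, Category.assoc, zero_comp]
  exact h
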